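/- Let p, q, p', q' ≥ 3 and r, r' ≥ 1 be integers. If the graphs d(p,q,r) and d(p',q',r') have the same signless Laplacian permanental polynomial, i.e., per(xI − Q(d(p,q,r))) = per(xI − Q(d(p',q',r'))) as polynomials in x, then d(p,q,r) is isomorphic to d(p',q',r') (equivalently, r = r' and {p,q} = {p',q'} as unordered pairs). -/

import Mathlib

open scoped Classical
open Polynomial

noncomputable section

/-- The signless Laplacian matrix `Q(G) = D(G) + A(G)` of a graph `G`. -/
def signlessLapMatrix {V : Type*} [Fintype V] (G : SimpleGraph V) : Matrix V V ℚ :=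
  G.degMatrix ℚ + G.adjMatrix ℚ

/-- The signless Laplacian permanental polynomial `per(x·I − Q(G))` of a graph `G`. -/
def qPermPoly {V : Type*} [Fintype V] (G : SimpleGraph V) : Polynomial ℚ :=
  Matrix.permanent
    (Matrix.diagonal (fun _ : V => (X : Polynomial ℚ)) - (signlessLapMatrix G).map Polynomial.C)

/-- The bicyclic graph `d(p,q,r)` on `p + q + r` vertices: vertices `0, …, p-1` form the
cycle `C_p`, vertices `p, …, p+q-1` form the cycle `C_q`, and vertices `p+q, …, p+q+r-1`
form a path of `r` internal vertices whose ends are joined to vertex `0` of `C_p` and to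
vertex `p` of `C_q` (i.e. a path on `r + 2` vertices has each end vertex identified with a
vertex of one of the two cycles). -/
def dGraph (p q r : ℕ) : SimpleGraph (Fin (p + q + r)) :=
  SimpleGraph.fromRel (fun i j =>
    (i.val + 1 = j.val ∧ j.val < p) ∨
    (i.val = p - 1 ∧ j.val = 0) ∨
    (i.val + 1 = j.val ∧ p ≤ i.val ∧ j.val < p + q) ∨
    (i.val = p + q - 1 ∧ j.val = p) ∨
    (i.val + 1 = j.val ∧ p + q ≤ i.val) ∨
    (i.val = 0 ∧ j.val = p + q) ∨
    (i.val = p + q + r - 1 ∧ j.val = p))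


/-! ### Permanents of finite sections of `ℕ × ℕ`-indexed matrices -/

section PerS

variable {R : Type*} [CommRing R]

/-- Laplace-type elimination of the vertex `none`. -/
lemma permanent_option {α : Type*} [Fintype α] [DecidableEq α] (M : Matrix (Option α) (Option α) R) :
    M.permanent = M none none * (M.submatrix some some).permanent +
      ∑ i : α, M (some i) none *
        (Matrix.updateRow (M.submatrix some some) i (fun j => M none (some j))).permanent := by
  have key : M.permanent = ∑ x : Option α × Equiv.Perm α,
      ∏ j, M (Equiv.Perm.decomposeOption.symm x j) j := by
    unfold Matrix.permanent
    exact (Equiv.sum_comp Equiv.Perm.decomposeOption.symm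
      (fun σ : Equiv.Perm (Option α) => ∏ j, M (σ j) j)).symm
  rw [key, Fintype.sum_prod_type, Fintype.sum_option]
  congr 1
  · simp [Matrix.permanent, Finset.mul_sum, Fintype.prod_option]
  · refine Finset.sum_congr rfl fun i _ => ?_
    simp only [Matrix.permanent, Finset.mul_sum]
    refine Finset.sum_congr rfl fun τ _ => ?_
    rw [Fintype.prod_option]
    congr 1
    refine Finset.prod_congr rfl fun j _ => ?_
    by_cases h : τ j = i
    · simp [h]
    · simp [h, Equiv.swap_apply_of_ne_of_ne]

/-- permanent is invariant under reindexing. -/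
lemma permanent_reindex {α β : Type*} [Fintype α] [DecidableEq α] [Fintype β] [DecidableEq β]
    (e : α ≃ β) (M : Matrix β β R) : (M.submatrix e e).permanent = M.permanent := by
  unfold Matrix.permanent
  refine Fintype.sum_equiv (Equiv.permCongr e) _ _ fun σ => ?_
  refine Fintype.prod_equiv e _ _ fun i => ?_
  simp [Equiv.permCongr_apply]

/-- permanent of the principal section of `M` on the finite set `S`. -/
def perS (M : ℕ → ℕ → R) (S : Finset ℕ) : R :=
  Matrix.permanent (Matrix.of fun i j : S => M i j)

/-- replace row `c` by `v`. -/
def updR (M : ℕ → ℕ → R) (c : ℕ) (v : ℕ → R) : ℕ → ℕ → R :=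
  fun i j => if i = c then v j else M i j

/-- replace column `c` by `v`. -/
def updC (M : ℕ → ℕ → R) (c : ℕ) (v : ℕ → R) : ℕ → ℕ → R :=
  fun i j => if j = c then v i else M i j

lemma perS_congr {M N : ℕ → ℕ → R} {S : Finset ℕ}
    (h : ∀ i ∈ S, ∀ j ∈ S, M i j = N i j) : perS M S = perS N S := by
  unfold perS
  congr 1
  funext i j
  exact h i i.2 j j.2

@[simp] lemma perS_empty (M : ℕ → ℕ → R) : perS M ∅ = 1 := by
  unfold perS
  exact Matrix.permanent_isEmpty

lemma perS_transpose (M : ℕ → ℕ → R) (S : Finset ℕ) :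
    perS (fun i j => M j i) S = perS M S := by
  unfold perS
  exact Matrix.permanent_transpose (Matrix.of fun i j : S => M i j)

/-- eliminate vertex `a` along its column. -/
lemma perS_insert_col (M : ℕ → ℕ → R) {a : ℕ} {S : Finset ℕ} (ha : a ∉ S) :
    perS M (insert a S) = M a a * perS M S + ∑ c ∈ S, M c a * perS (updR M c (M a)) S := by
  have h1 : perS M (insert a S) =
      Matrix.permanent (Matrix.of fun i j : Option S =>
        M ((Finset.subtypeInsertEquivOption ha).symm i) ((Finset.subtypeInsertEquivOption ha).symm j)) := by
    unfold perS
    exact (permanent_reindex (Finset.subtypeInsertEquivOption ha).symm _).symm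
  rw [h1, permanent_option, ← Finset.sum_coe_sort S]
  congr 1
  refine Finset.sum_congr rfl fun c _ => ?_
  unfold perS
  congr 2
  funext i j
  by_cases h : i = c
  · subst h; simp [updR, Finset.subtypeInsertEquivOption]
  · simp [updR, Finset.subtypeInsertEquivOption, h]

/-- eliminate vertex `a` along its row. -/
lemma perS_insert_row (M : ℕ → ℕ → R) {a : ℕ} {S : Finset ℕ} (ha : a ∉ S) :
    perS M (insert a S) = M a a * perS M S +
      ∑ c ∈ S, M a c * perS (updC M c (fun i => M i a)) S := by
  rw [← perS_transpose, perS_insert_col _ ha, perS_transpose]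
  congr 1
  refine Finset.sum_congr rfl fun c _ => ?_
  rw [← perS_transpose]
  rfl

lemma perS_zero_row {M : ℕ → ℕ → R} {S : Finset ℕ} {c : ℕ} (hc : c ∈ S)
    (h : ∀ j ∈ S, M c j = 0) : perS M S = 0 := by
  obtain ⟨T, hT, rfl⟩ : ∃ T, c ∉ T ∧ insert c T = S :=
    ⟨S.erase c, by simp, Finset.insert_erase hc⟩
  rw [perS_insert_row _ hT, h c (by simp), zero_mul, zero_add]
  refine Finset.sum_eq_zero fun j hj => ?_
  rw [h j (by simp [hj]), zero_mul]

lemma perS_zero_col {M : ℕ → ℕ → R} {S : Finset ℕ} {c : ℕ} (hc : c ∈ S)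
    (h : ∀ i ∈ S, M i c = 0) : perS M S = 0 := by
  rw [← perS_transpose]
  exact perS_zero_row hc h

/-- column `c` has only a diagonal entry. -/
lemma perS_single_col {M : ℕ → ℕ → R} {S : Finset ℕ} {c : ℕ} (hc : c ∈ S)
    (h : ∀ i ∈ S, i ≠ c → M i c = 0) : perS M S = M c c * perS M (S.erase c) := by
  conv_lhs => rw [← Finset.insert_erase hc]
  rw [perS_insert_col _ (by simp)]
  rw [Finset.sum_eq_zero, add_zero]
  intro i hi
  rw [h i (Finset.mem_of_mem_erase hi) (Finset.ne_of_mem_erase hi), zero_mul]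

/-- linearity in column `c`. -/
lemma perS_updC_lin (M : ℕ → ℕ → R) {S : Finset ℕ} {c : ℕ} (hc : c ∈ S) (x y : R) (v w : ℕ → R) :
    perS (updC M c (fun i => x * v i + y * w i)) S =
      x * perS (updC M c v) S + y * perS (updC M c w) S := by
  have aux : ∀ u : ℕ → R, perS (updC M c u) S = u c * perS M (S.erase c) +
      ∑ i ∈ S.erase c, u i * perS (updR M i (M c)) (S.erase c) := by
    intro u
    conv_lhs => rw [← Finset.insert_erase hc]
    rw [perS_insert_col _ (by simp)]
    congr 1
    · congr 1
      · simp [updC]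
      · refine perS_congr fun i _ j hj => ?_
        simp [updC, Finset.ne_of_mem_erase hj]
    · refine Finset.sum_congr rfl fun i hi => ?_
      congr 1
      · simp [updC]
      · refine perS_congr fun i _ j hj => ?_
        simp [updR, updC, Finset.ne_of_mem_erase hj]
  rw [aux, aux v, aux w]
  simp only [add_mul, Finset.sum_add_distrib, mul_add, Finset.mul_sum, mul_assoc]
  ring

/-- block triangular permanents. -/
lemma perS_block (A : Finset ℕ) : ∀ (M : ℕ → ℕ → R) (B : Finset ℕ), Disjoint A B →
    (∀ i ∈ A, ∀ j ∈ B, M i j = 0) → perS M (A ∪ B) = perS M A * perS M B := by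
  induction A using Finset.induction_on with
  | empty => intro M B _ _; simp
  | insert a A ha ih =>
    intro M B hd h
    have hd' : Disjoint A B := Finset.disjoint_of_subset_left (Finset.subset_insert _ _) hd
    have haB : a ∉ B := Finset.disjoint_left.1 hd (by simp)
    rw [Finset.insert_union, perS_insert_row _ (by simp [ha, haB]), perS_insert_row _ ha,
      ih M B hd' (fun i hi j hj => h i (by simp [hi]) j hj), add_mul, mul_assoc]
    congr 1
    rw [Finset.sum_union hd', Finset.sum_mul]
    have hB : ∑ c ∈ B, M a c * perS (updC M c (fun i => M i a)) (A ∪ B) = 0 :=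
      Finset.sum_eq_zero fun c hc => by rw [h a (by simp) c hc, zero_mul]
    rw [hB, add_zero]
    refine Finset.sum_congr rfl fun c hc => ?_
    have hcB : ∀ j ∈ B, j ≠ c := fun j hj e => Finset.disjoint_left.1 hd' hc (e ▸ hj)
    rw [ih _ B hd', mul_assoc]
    · congr 2
      refine perS_congr fun i _ j hj => ?_
      simp [updC, hcB j hj]
    · intro i hi j hj
      simp [updC, hcB j hj, h i (by simp [hi]) j hj]

/-- two pieces joined by a single edge `a b`. -/
lemma perS_bridge (M : ℕ → ℕ → R) {A B : Finset ℕ} {a b : ℕ} (hd : Disjoint A B)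
    (ha : a ∈ A) (hb : b ∈ B)
    (h1 : ∀ i ∈ A, ∀ j ∈ B, ¬ (i = a ∧ j = b) → M i j = 0)
    (h2 : ∀ i ∈ A, ∀ j ∈ B, ¬ (i = a ∧ j = b) → M j i = 0) :
    perS M (A ∪ B) = perS M A * perS M B +
      M a b * M b a * (perS M (A.erase a) * perS M (B.erase b)) := by
  obtain ⟨A', hA', rfl⟩ : ∃ T, a ∉ T ∧ insert a T = A :=
    ⟨A.erase a, by simp, Finset.insert_erase ha⟩
  have hd' : Disjoint A' B := Finset.disjoint_of_subset_left (Finset.subset_insert _ _) hd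
  have haB : a ∉ B := Finset.disjoint_left.1 hd (by simp)
  have hne : ∀ i ∈ A', i ≠ a := fun i hi e => hA' (e ▸ hi)
  rw [Finset.erase_insert hA', Finset.insert_union, perS_insert_row _ (by simp [hA', haB]),
    perS_insert_row _ hA', Finset.sum_union hd',
    perS_block A' M B hd' (fun i hi j hj => h1 i (by simp [hi]) j hj (by simp [hne i hi]))]
  have e1 : ∑ c ∈ A', M a c * perS (updC M c (fun i => M i a)) (A' ∪ B) =
      (∑ c ∈ A', M a c * perS (updC M c (fun i => M i a)) A') * perS M B := by
    rw [Finset.sum_mul]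
    refine Finset.sum_congr rfl fun c hc => ?_
    have hcB : ∀ j ∈ B, j ≠ c := fun j hj e => Finset.disjoint_left.1 hd' hc (e ▸ hj)
    rw [perS_block A' _ B hd', mul_assoc]
    · congr 2
      refine perS_congr fun i _ j hj => ?_
      simp [updC, hcB j hj]
    · intro i hi j hj
      simp [updC, hcB j hj, h1 i (by simp [hi]) j hj (by simp [hne i hi])]
  have e2 : ∑ c ∈ B, M a c * perS (updC M c (fun i => M i a)) (A' ∪ B) =
      M a b * (M b a * (perS M A' * perS M (B.erase b))) := by
    rw [Finset.sum_eq_single b]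
    · congr 1
      have hbA : ∀ j ∈ A', j ≠ b := fun j hj e => Finset.disjoint_left.1 hd' hj (e ▸ hb)
      rw [Finset.union_comm, perS_block B _ A' hd'.symm]
      · rw [perS_single_col hb]
        · have q1 : perS (updC M b (fun i => M i a)) (B.erase b) = perS M (B.erase b) := by
            refine perS_congr fun i _ j hj => ?_
            simp [updC, Finset.ne_of_mem_erase hj]
          have q2 : perS (updC M b (fun i => M i a)) A' = perS M A' := by
            refine perS_congr fun i _ j hj => ?_
            simp [updC, hbA j hj]
          rw [q1, q2]
          simp only [updC, if_true]
          ring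
        · intro i hi hib
          simp only [updC, if_true]
          exact h2 a (by simp) i hi (by simp [hib])
      · intro i hi j hj
        simp only [updC, hbA j hj, if_false]
        exact h2 j (by simp [hj]) i hi (by simp [hne j hj])
    · intro c hc hcb
      rw [h1 a (by simp) c hc (by simp [hcb]), zero_mul]
    · intro h; exact absurd hb h
  rw [e1, e2]
  ring

lemma perS_singleton (M : ℕ → ℕ → R) (a : ℕ) : perS M {a} = M a a := by
  have := perS_insert_col M (a := a) (S := ∅) (by simp)
  simpa using this

end PerS

/-! ### Paths and cycles -/

section PathCycle

variable {R : Type*} [CommRing R]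

/-- attach a leaf `a` to the vertex `b` of `B`. -/
lemma perS_leaf (M : ℕ → ℕ → R) {B : Finset ℕ} {a b : ℕ} (ha : a ∉ B) (hb : b ∈ B)
    (hab : M a b = -1) (hba : M b a = -1)
    (h1 : ∀ j ∈ B, j ≠ b → M a j = 0) (h2 : ∀ j ∈ B, j ≠ b → M j a = 0) :
    perS M (insert a B) = M a a * perS M B + perS M (B.erase b) := by
  have := perS_bridge M (A := {a}) (B := B) (a := a) (b := b) (by simpa using ha) (by simp) hb
    (by
      intro i hi j hj h
      rw [Finset.mem_singleton] at hi
      subst hi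
      exact h1 j hj (fun e => h ⟨rfl, e⟩))
    (by
      intro i hi j hj h
      rw [Finset.mem_singleton] at hi
      subst hi
      exact h2 j hj (fun e => h ⟨rfl, e⟩))
  rw [← Finset.insert_eq] at this
  rw [this, perS_singleton, hab, hba]
  simp

/-- `M` restricted to `[k, k+n)` is the path matrix with diagonal `y`. -/
def IsPathOn (M : ℕ → ℕ → R) (y : R) (k n : ℕ) : Prop :=
  ∀ i ∈ Finset.Ico k (k + n), ∀ j ∈ Finset.Ico k (k + n),
    M i j = if i = j then y else if i + 1 = j ∨ j + 1 = i then -1 else 0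

lemma IsPathOn.mono {M : ℕ → ℕ → R} {y : R} {k n k' n' : ℕ} (h : IsPathOn M y k n)
    (h1 : k ≤ k') (h2 : k' + n' ≤ k + n) : IsPathOn M y k' n' := by
  intro i hi j hj
  simp only [Finset.mem_Ico] at hi hj
  exact h i (by simp only [Finset.mem_Ico]; omega) j (by simp only [Finset.mem_Ico]; omega)

lemma IsPathOn.transpose {M : ℕ → ℕ → R} {y : R} {k n : ℕ} (h : IsPathOn M y k n) :
    IsPathOn (fun i j => M j i) y k n := by
  intro i hi j hj
  simp only
  rw [h j hj i hi]
  simp only [eq_comm (a := j) (b := i), or_comm]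

lemma Ico_insert_left {k m : ℕ} (h : k < m) :
    Finset.Ico k m = insert k (Finset.Ico (k + 1) m) := by
  ext x; simp only [Finset.mem_Ico, Finset.mem_insert]; omega

lemma Ico_erase_left {k m : ℕ} : (Finset.Ico k m).erase k = Finset.Ico (k + 1) m := by
  ext x; simp only [Finset.mem_Ico, Finset.mem_erase]; omega

lemma perS_path {y t s : R} (hts : t * s = -1) (hy : y = t + s) (n : ℕ) :
    ∀ (M : ℕ → ℕ → R) (k : ℕ), IsPathOn M y k n →
      (t - s) * perS M (Finset.Ico k (k + n)) = t ^ (n + 1) - s ^ (n + 1) := by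
  induction n using Nat.twoStepInduction with
  | zero => intro M k _; simp
  | one =>
    intro M k h
    have : Finset.Ico k (k + 1) = {k} := by ext x; simp
    rw [this, perS_singleton, h k (by simp) k (by simp), if_pos rfl, hy]
    ring
  | more n ih1 ih2 =>
    intro M k h
    have e := fun i j (hi : k ≤ i ∧ i < k + (n + 2)) (hj : k ≤ j ∧ j < k + (n + 2)) =>
      h i (Finset.mem_Ico.2 hi) j (Finset.mem_Ico.2 hj)
    rw [Ico_insert_left (by omega), perS_leaf M (b := k + 1) (by simp) (by simp), Ico_erase_left,
      mul_add]
    · have a1 := ih2 M (k + 1) (h.mono (by omega) (by omega))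
      have a2 := ih1 M (k + 2) (h.mono (by omega) (by omega))
      rw [show k + 1 + (n + 1) = k + (n + 2) by ring] at a1
      rw [show k + 2 + n = k + (n + 2) by ring] at a2
      rw [show k + 1 + 1 = k + 2 by ring, a2, mul_left_comm, a1, e k k (by omega) (by omega),
        if_pos rfl, hy]
      linear_combination (t ^ (n + 1) - s ^ (n + 1)) * hts
    · rw [e _ _ (by omega) (by omega), if_neg (by omega), if_pos (by omega)]
    · rw [e _ _ (by omega) (by omega), if_neg (by omega), if_pos (by omega)]
    · intro j hj hne
      rw [Finset.mem_Ico] at hj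
      rw [e _ _ (by omega) (by omega), if_neg (by omega), if_neg (by omega)]
    · intro j hj hne
      rw [Finset.mem_Ico] at hj
      rw [e _ _ (by omega) (by omega), if_neg (by omega), if_neg (by omega)]

/-- unit vector -/
def unitV (k : ℕ) : ℕ → R := fun i => if i = k then 1 else 0

lemma perS_Xcol {y : R} (n : ℕ) : ∀ (M : ℕ → ℕ → R) (k : ℕ), IsPathOn M y k (n + 1) →
    perS (updC M (k + n) (unitV k)) (Finset.Ico k (k + n + 1)) = (-1) ^ n := by
  induction n with
  | zero =>
    intro M k h
    have : Finset.Ico k (k + 0 + 1) = {k} := by ext x; simp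
    rw [this, perS_singleton]
    simp [updC, unitV]
  | succ n ih =>
    intro M k h
    rw [Ico_insert_left (by omega), perS_insert_row _ (by simp)]
    have z : perS (updC M (k + (n + 1)) (unitV k)) (Finset.Ico (k + 1) (k + (n + 1) + 1)) = 0 := by
      refine perS_zero_col (c := k + (n + 1)) (by simp) ?_
      intro i hi
      rw [Finset.mem_Ico] at hi
      simp only [updC, unitV, if_true]
      rw [if_neg (by omega)]
    rw [z, mul_zero, zero_add, Finset.sum_eq_single (k + (n + 1))]
    · have a := ih M (k + 1) (h.mono (by omega) (by omega))
      rw [show k + 1 + n = k + (n + 1) by ring] at a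
      have b := perS_updC_lin M (S := Finset.Ico (k + 1) (k + (n + 1) + 1)) (c := k + (n + 1))
        (by simp) (-1) 0 (unitV (k + 1)) (unitV (k + 1))
      rw [a] at b
      have c : perS (updC (updC M (k + (n + 1)) (unitV k)) (k + (n + 1))
          (fun i => updC M (k + (n + 1)) (unitV k) i k)) (Finset.Ico (k + 1) (k + (n + 1) + 1)) =
          perS (updC M (k + (n + 1)) (fun i => -1 * unitV (k + 1) i + 0 * unitV (k + 1) i))
            (Finset.Ico (k + 1) (k + (n + 1) + 1)) := by
        refine perS_congr fun i hi j hj => ?_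
        rw [Finset.mem_Ico] at hi
        simp only [updC, unitV]
        split_ifs
        all_goals first
          | omega
          | rfl
          | (rw [h i (by simp only [Finset.mem_Ico]; omega) k (by simp only [Finset.mem_Ico]; omega),
              if_neg (by omega)]
             first
              | rw [if_pos (by omega)]; ring
              | rw [if_neg (by omega)]; ring)
      rw [c, b]
      simp only [updC, unitV, if_true]
      ring
    · intro c hc hne
      have z' : perS (updC (updC M (k + (n + 1)) (unitV k)) c
          (fun i => updC M (k + (n + 1)) (unitV k) i k))
          (Finset.Ico (k + 1) (k + (n + 1) + 1)) = 0 := by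
        refine perS_zero_col (c := k + (n + 1)) (by simp) ?_
        intro i hi
        rw [Finset.mem_Ico] at hi
        simp only [updC, unitV, if_true]
        rw [if_neg (Ne.symm hne), if_neg (by omega)]
      rw [z', mul_zero]
    · intro h; exact absurd (by simp) h

lemma perS_Xrow {y : R} (n : ℕ) (M : ℕ → ℕ → R) (k : ℕ) (h : IsPathOn M y k (n + 1)) :
    perS (updR M (k + n) (unitV k)) (Finset.Ico k (k + n + 1)) = (-1) ^ n := by
  rw [← perS_Xcol n _ k h.transpose, ← perS_transpose]
  rfl

lemma perS_Xcol' {y : R} (n : ℕ) (M : ℕ → ℕ → R) (k : ℕ) (h : IsPathOn M y k (n + 2)) :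
    perS (updC M k (unitV (k + n + 1))) (Finset.Ico k (k + n + 2)) = (-1) ^ (n + 1) := by
  rw [Ico_insert_left (by omega), perS_insert_col _ (by simp)]
  have e1 : (updC M k (unitV (k + n + 1))) k k = 0 := by
    simp only [updC, unitV, if_true]; rw [if_neg (by omega)]
  rw [e1, zero_mul, zero_add, Finset.sum_eq_single (k + n + 1)]
  · have a := perS_Xrow n M (k + 1) (h.mono (by omega) (by omega))
    rw [show k + 1 + n = k + n + 1 by ring] at a
    have b := perS_updC_lin (fun i j => M j i) (S := Finset.Ico (k + 1) (k + n + 2)) (c := k + n + 1)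
        (by simp) (-1) 0 (unitV (k + 1)) (unitV (k + 1))
    have a' : perS (updC (fun i j => M j i) (k + n + 1) (unitV (k + 1)))
        (Finset.Ico (k + 1) (k + n + 2)) = (-1) ^ n := by
      rw [← a, ← perS_transpose]; rfl
    rw [a'] at b
    have c : perS (updR (updC M k (unitV (k + n + 1))) (k + n + 1)
        (updC M k (unitV (k + n + 1)) k)) (Finset.Ico (k + 1) (k + n + 2)) =
        perS (updC (fun i j => M j i) (k + n + 1)
          (fun i => -1 * unitV (k + 1) i + 0 * unitV (k + 1) i))
            (Finset.Ico (k + 1) (k + n + 2)) := by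
      rw [← perS_transpose]
      refine perS_congr fun i hi j hj => ?_
      rw [Finset.mem_Ico] at hi hj
      simp only [updC, updR, unitV]
      split_ifs
      all_goals first
          | omega
          | rfl
          | (rw [h k (by simp only [Finset.mem_Ico]; omega) i (by simp only [Finset.mem_Ico]; omega),
              if_neg (by omega)]
             first
              | rw [if_pos (by omega)]; ring
              | rw [if_neg (by omega)]; ring)
    rw [c, b]
    simp only [updC, unitV, if_true]
    ring
  · intro c hc hne
    simp only [updC, unitV, if_true]
    rw [if_neg hne, zero_mul]
  · intro h; exact absurd (by simp) h

lemma perS_unit_col (M : ℕ → ℕ → R) {S : Finset ℕ} {c : ℕ} (hc : c ∈ S) :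
    perS (updC M c (unitV c)) S = perS M (S.erase c) := by
  rw [perS_single_col hc]
  · have : perS (updC M c (unitV c)) (S.erase c) = perS M (S.erase c) := by
      refine perS_congr fun i _ j hj => ?_
      simp [updC, Finset.ne_of_mem_erase hj]
    rw [this]
    simp [updC, unitV]
  · intro i _ h
    simp [updC, unitV, h]

/-- permanent of a cycle rooted at `k`. -/
lemma perS_cycle {y : R} (m : ℕ) (M : ℕ → ℕ → R) (k : ℕ)
    (hp : IsPathOn M y (k + 1) (m + 2))
    (hr : ∀ j ∈ Finset.Ico (k + 1) (k + m + 3),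
      M k j = if j = k + 1 ∨ j = k + m + 2 then -1 else 0)
    (hc : ∀ j ∈ Finset.Ico (k + 1) (k + m + 3),
      M j k = if j = k + 1 ∨ j = k + m + 2 then -1 else 0) :
    perS M (Finset.Ico k (k + m + 3)) = M k k * perS M (Finset.Ico (k + 1) (k + m + 3)) +
      perS M (Finset.Ico (k + 2) (k + m + 3)) + perS M (Finset.Ico (k + 1) (k + m + 2)) +
      2 * (-1) ^ (m + 3) := by
  rw [Ico_insert_left (by omega), perS_insert_row _ (by simp)]
  have key : ∀ c ∈ Finset.Ico (k + 1) (k + m + 3),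
      perS (updC M c (fun i => M i k)) (Finset.Ico (k + 1) (k + m + 3)) =
      -1 * perS (updC M c (unitV (k + 1))) (Finset.Ico (k + 1) (k + m + 3)) +
      -1 * perS (updC M c (unitV (k + m + 2))) (Finset.Ico (k + 1) (k + m + 3)) := by
    intro c hcm
    rw [← perS_updC_lin M hcm]
    refine perS_congr fun i hi j hj => ?_
    simp only [updC, unitV]
    rw [hc i hi]
    split_ifs
    all_goals first
      | omega
      | ring
  have x1 := perS_Xcol (m + 1) M (k + 1) hp
  have x2 := perS_Xcol' m M (k + 1) hp
  rw [show k + 1 + (m + 1) = k + m + 2 by ring] at x1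
  rw [show k + 1 + m + 1 = k + m + 2 by ring, show k + 1 + m + 2 = k + m + 3 by ring] at x2
  have u1 := perS_unit_col M (S := Finset.Ico (k + 1) (k + m + 3)) (c := k + 1)
    (by simp only [Finset.mem_Ico]; omega)
  have u2 := perS_unit_col M (S := Finset.Ico (k + 1) (k + m + 3)) (c := k + m + 2)
    (by simp only [Finset.mem_Ico]; omega)
  rw [Ico_erase_left] at u1
  rw [show (Finset.Ico (k + 1) (k + m + 3)).erase (k + m + 2) = Finset.Ico (k + 1) (k + m + 2) by
    ext x; simp only [Finset.mem_Ico, Finset.mem_erase]; omega] at u2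
  have hsum : ∑ c ∈ Finset.Ico (k + 1) (k + m + 3),
      M k c * perS (updC M c (fun i => M i k)) (Finset.Ico (k + 1) (k + m + 3)) =
      ∑ c ∈ {k + 1, k + m + 2},
      M k c * perS (updC M c (fun i => M i k)) (Finset.Ico (k + 1) (k + m + 3)) := by
    symm
    refine Finset.sum_subset ?_ ?_
    · intro x
      simp only [Finset.mem_insert, Finset.mem_singleton, Finset.mem_Ico]
      omega
    · intro x hx hx'
      simp only [Finset.mem_insert, Finset.mem_singleton] at hx'
      rw [hr x hx, if_neg hx', zero_mul]
  rw [hsum, Finset.sum_pair (by omega), key (k + 1) (by simp only [Finset.mem_Ico]; omega),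
    key (k + m + 2) (by simp only [Finset.mem_Ico]; omega),
    hr (k + 1) (by simp only [Finset.mem_Ico]; omega), hr (k + m + 2) (by simp only [Finset.mem_Ico]; omega),
    if_pos (by simp), if_pos (by simp), u1, u2, x2]
  rw [show k + m + 2 + 1 = k + m + 3 by ring] at x1
  rw [x1]
  ring

end PathCycle

/-! ### The matrix of `d(p,q,r)` -/

section DMat

/-- the generating relation of `dGraph`, on natural numbers. -/
def dRel (p q r i j : ℕ) : Prop :=
    (i + 1 = j ∧ j < p) ∨
    (i = p - 1 ∧ j = 0) ∨
    (i + 1 = j ∧ p ≤ i ∧ j < p + q) ∨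
    (i = p + q - 1 ∧ j = p) ∨
    (i + 1 = j ∧ p + q ≤ i) ∨
    (i = 0 ∧ j = p + q) ∨
    (i = p + q + r - 1 ∧ j = p)

/-- The matrix `xI - Q(d(p,q,r))` with `y = x - 2`. -/
def dM (p q r : ℕ) (y : ℚ) (i j : ℕ) : ℚ :=
  if i = j then (if i = 0 ∨ i = p then y - 1 else y)
  else if dRel p q r i j ∨ dRel p q r j i then -1 else 0

lemma dM_adj {p q r : ℕ} {y : ℚ} {i j : ℕ} (h : i ≠ j) (h' : dRel p q r i j ∨ dRel p q r j i) :
    dM p q r y i j = -1 := by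
  unfold dM; rw [if_neg h, if_pos h']

lemma dM_nadj {p q r : ℕ} {y : ℚ} {i j : ℕ} (h : i ≠ j)
    (h' : ¬ (dRel p q r i j ∨ dRel p q r j i)) :
    dM p q r y i j = 0 := by
  unfold dM; rw [if_neg h, if_neg h']

lemma dM_diag {p q r : ℕ} {y : ℚ} {i : ℕ} (h : i ≠ 0) (h' : i ≠ p) :
    dM p q r y i i = y := by
  unfold dM; rw [if_pos rfl, if_neg (by omega)]

lemma dRel_p {p q r i j : ℕ} (hi : 1 ≤ i ∧ i < p) (hj : 1 ≤ j ∧ j < p) :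
    dRel p q r i j ↔ i + 1 = j := by
  unfold dRel
  constructor
  · rintro (h | h | h | h | h | h | h) <;> omega
  · intro h; left; omega

lemma dRel_q {p q r i j : ℕ} (hi : p + 1 ≤ i ∧ i < p + q) (hj : p + 1 ≤ j ∧ j < p + q) :
    dRel p q r i j ↔ i + 1 = j := by
  unfold dRel
  constructor
  · rintro (h | h | h | h | h | h | h) <;> omega
  · intro h; right; right; left; omega

lemma cycle_closed {t s y : ℚ} (hts : t * s = -1) (hy : y = t + s) (m : ℕ) (M : ℕ → ℕ → ℚ)
    (k : ℕ) (hk : M k k = y - 1)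
    (hp : IsPathOn M y (k + 1) (m + 2))
    (hr : ∀ j ∈ Finset.Ico (k + 1) (k + m + 3),
      M k j = if j = k + 1 ∨ j = k + m + 2 then -1 else 0)
    (hc : ∀ j ∈ Finset.Ico (k + 1) (k + m + 3),
      M j k = if j = k + 1 ∨ j = k + m + 2 then -1 else 0) :
    (t - s) * perS M (Finset.Ico k (k + (m + 3))) =
      (t ^ (m + 3) + s ^ (m + 3)) * (t - s) - (t ^ (m + 3) - s ^ (m + 3)) +
        2 * (-1) ^ (m + 3) * (t - s) ∧
    (t - s) * perS M (Finset.Ico (k + 1) (k + (m + 3))) = t ^ (m + 3) - s ^ (m + 3) := by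
  have h1 := perS_path hts hy (m + 2) M (k + 1) hp
  have h2 := perS_path hts hy (m + 1) M (k + 2) (hp.mono (by omega) (by omega))
  have h3 := perS_path hts hy (m + 1) M (k + 1) (hp.mono (by omega) (by omega))
  rw [show k + 1 + (m + 2) = k + m + 3 by ring] at h1
  rw [show k + 2 + (m + 1) = k + m + 3 by ring] at h2
  rw [show k + 1 + (m + 1) = k + m + 2 by ring] at h3
  rw [show k + (m + 3) = k + m + 3 by ring]
  refine ⟨?_, by rw [h1]⟩
  rw [perS_cycle m M k hp hr hc, hk, hy]
  subst hy
  linear_combination (t + s - 1) * h1 + h2 + h3 + 2 * (t ^ (m + 2) - s ^ (m + 2)) * hts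

lemma dM_cycle_p {t s y : ℚ} (hts : t * s = -1) (hy : y = t + s) {p q r : ℕ} (hp : 3 ≤ p)
    (hq : 3 ≤ q) (hr : 1 ≤ r) :
    (t - s) * perS (dM p q r y) (Finset.Ico 0 p) =
      (t ^ p + s ^ p) * (t - s) - (t ^ p - s ^ p) + 2 * (-1) ^ p * (t - s) ∧
    (t - s) * perS (dM p q r y) (Finset.Ico 1 p) = t ^ p - s ^ p := by
  obtain ⟨m, rfl⟩ : ∃ m, p = m + 3 := ⟨p - 3, by omega⟩
  have := cycle_closed hts hy m (dM (m + 3) q r y) 0 (by simp [dM])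
    (by
      intro i hi j hj
      rw [Finset.mem_Ico] at hi hj
      by_cases e : i = j
      · subst e; rw [if_pos rfl, dM_diag (by omega) (by omega)]
      · rw [if_neg e]
        split_ifs with e2
        · exact dM_adj e (by rw [dRel_p (by omega) (by omega), dRel_p (by omega) (by omega)]; exact e2)
        · exact dM_nadj e (by rw [dRel_p (by omega) (by omega), dRel_p (by omega) (by omega)]; exact e2))
    (by
      intro j hj
      rw [Finset.mem_Ico] at hj
      split_ifs with e2
      · refine dM_adj (by omega) ?_
        unfold dRel
        rcases e2 with e2 | e2
        · left; left; omega
        · right; right; left; omega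
      · exact dM_nadj (by omega) (by
        unfold dRel
        rintro ((h | h | h | h | h | h | h) | (h | h | h | h | h | h | h)) <;> omega))
    (by
      intro j hj
      rw [Finset.mem_Ico] at hj
      split_ifs with e2
      · refine dM_adj (by omega) ?_
        unfold dRel
        rcases e2 with e2 | e2
        · right; left; omega
        · left; right; left; omega
      · exact dM_nadj (by omega) (by
        unfold dRel
        rintro ((h | h | h | h | h | h | h) | (h | h | h | h | h | h | h)) <;> omega))
  simpa only [zero_add] using this

lemma dM_cycle_q {t s y : ℚ} (hts : t * s = -1) (hy : y = t + s) {p q r : ℕ} (hp : 3 ≤ p)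
    (hq : 3 ≤ q) (hr : 1 ≤ r) :
    (t - s) * perS (dM p q r y) (Finset.Ico p (p + q)) =
      (t ^ q + s ^ q) * (t - s) - (t ^ q - s ^ q) + 2 * (-1) ^ q * (t - s) ∧
    (t - s) * perS (dM p q r y) (Finset.Ico (p + 1) (p + q)) = t ^ q - s ^ q := by
  obtain ⟨m, rfl⟩ : ∃ m, q = m + 3 := ⟨q - 3, by omega⟩
  exact cycle_closed hts hy m (dM p (m + 3) r y) p (by simp [dM])
    (by
      intro i hi j hj
      rw [Finset.mem_Ico] at hi hj
      by_cases e : i = j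
      · subst e; rw [if_pos rfl, dM_diag (by omega) (by omega)]
      · rw [if_neg e]
        split_ifs with e2
        · exact dM_adj e (by rw [dRel_q (by omega) (by omega), dRel_q (by omega) (by omega)]; exact e2)
        · exact dM_nadj e (by rw [dRel_q (by omega) (by omega), dRel_q (by omega) (by omega)]; exact e2))
    (by
      intro j hj
      rw [Finset.mem_Ico] at hj
      split_ifs with e2
      · refine dM_adj (by omega) ?_
        unfold dRel
        rcases e2 with e2 | e2
        · left; right; right; left; omega
        · right; right; right; right; left; omega
      · exact dM_nadj (by omega) (by
        unfold dRel
        rintro ((h | h | h | h | h | h | h) | (h | h | h | h | h | h | h)) <;> omega))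
    (by
      intro j hj
      rw [Finset.mem_Ico] at hj
      split_ifs with e2
      · refine dM_adj (by omega) ?_
        unfold dRel
        rcases e2 with e2 | e2
        · right; right; right; left; omega
        · left; right; right; right; left; omega
      · exact dM_nadj (by omega) (by
        unfold dRel
        rintro ((h | h | h | h | h | h | h) | (h | h | h | h | h | h | h)) <;> omega))

/-- tail: the last `j` path vertices together with the second cycle. -/
lemma dM_tail {t s y : ℚ} (hts : t * s = -1) (hy : y = t + s) {p q r : ℕ} (hp : 3 ≤ p)
    (hq : 3 ≤ q) (hr : 1 ≤ r) (j : ℕ) : j ≤ r →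
    (t - s) * perS (dM p q r y) (Finset.Ico (p + q + r - j) (p + q + r) ∪ Finset.Ico p (p + q)) =
      t ^ j * (perS (dM p q r y) (Finset.Ico p (p + q)) * t +
        perS (dM p q r y) (Finset.Ico (p + 1) (p + q))) -
      s ^ j * (perS (dM p q r y) (Finset.Ico p (p + q)) * s +
        perS (dM p q r y) (Finset.Ico (p + 1) (p + q))) := by
  induction j using Nat.twoStepInduction with
  | zero => intro _; simp; ring
  | one =>
    intro _
    have e1 : Finset.Ico (p + q + r - 1) (p + q + r) ∪ Finset.Ico p (p + q) =
        insert (p + q + r - 1) (Finset.Ico p (p + q)) := by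
      ext x; simp only [Finset.mem_union, Finset.mem_insert, Finset.mem_Ico]; omega
    rw [e1, perS_leaf (b := p), Ico_erase_left, dM_diag (by omega) (by omega), hy]
    · ring
    · simp only [Finset.mem_Ico]; omega
    · simp only [Finset.mem_Ico]; omega
    · exact dM_adj (by omega) (by unfold dRel; omega)
    · exact dM_adj (by omega) (by unfold dRel; omega)
    · intro i hi hne
      rw [Finset.mem_Ico] at hi
      exact dM_nadj (by omega) (by
        unfold dRel
        rintro ((h | h | h | h | h | h | h) | (h | h | h | h | h | h | h)) <;> omega)
    · intro i hi hne
      rw [Finset.mem_Ico] at hi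
      exact dM_nadj (by omega) (by
        unfold dRel
        rintro ((h | h | h | h | h | h | h) | (h | h | h | h | h | h | h)) <;> omega)
  | more j ih1 ih2 =>
    intro hj
    have a1 := ih1 (by omega)
    have a2 := ih2 (by omega)
    have e1 : Finset.Ico (p + q + r - (j + 2)) (p + q + r) ∪ Finset.Ico p (p + q) =
        insert (p + q + r - (j + 2))
          (Finset.Ico (p + q + r - (j + 1)) (p + q + r) ∪ Finset.Ico p (p + q)) := by
      ext x; simp only [Finset.mem_union, Finset.mem_insert, Finset.mem_Ico]; omega
    have e2 : (Finset.Ico (p + q + r - (j + 1)) (p + q + r) ∪ Finset.Ico p (p + q)).erase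
        (p + q + r - (j + 1)) =
        Finset.Ico (p + q + r - j) (p + q + r) ∪ Finset.Ico p (p + q) := by
      ext x; simp only [Finset.mem_union, Finset.mem_erase, Finset.mem_Ico]; omega
    rw [e1, perS_leaf (b := p + q + r - (j + 1)), e2, dM_diag (by omega) (by omega)]
    · generalize perS (dM p q r y) (Finset.Ico p (p + q)) = A at *
      generalize perS (dM p q r y) (Finset.Ico (p + 1) (p + q)) = B at *
      subst hy
      linear_combination (t + s) * a2 + a1 + (t ^ j * (A * t + B) - s ^ j * (A * s + B)) * hts
    · simp only [Finset.mem_union, Finset.mem_Ico]; omega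
    · simp only [Finset.mem_union, Finset.mem_Ico]; omega
    · exact dM_adj (by omega) (by unfold dRel; omega)
    · exact dM_adj (by omega) (by unfold dRel; omega)
    · intro i hi hne
      simp only [Finset.mem_union, Finset.mem_Ico] at hi
      exact dM_nadj (by omega) (by
        unfold dRel
        rintro ((h | h | h | h | h | h | h) | (h | h | h | h | h | h | h)) <;> omega)
    · intro i hi hne
      simp only [Finset.mem_union, Finset.mem_Ico] at hi
      exact dM_nadj (by omega) (by
        unfold dRel
        rintro ((h | h | h | h | h | h | h) | (h | h | h | h | h | h | h)) <;> omega)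

lemma dM_bridge {p q r : ℕ} (y : ℚ) (hp : 3 ≤ p) (hq : 3 ≤ q) (hr : 1 ≤ r) :
    perS (dM p q r y) (Finset.range (p + q + r)) =
      perS (dM p q r y) (Finset.Ico 0 p) *
        perS (dM p q r y) (Finset.Ico (p + q + r - r) (p + q + r) ∪ Finset.Ico p (p + q)) +
      perS (dM p q r y) (Finset.Ico 1 p) *
        perS (dM p q r y) (Finset.Ico (p + q + r - (r - 1)) (p + q + r) ∪ Finset.Ico p (p + q)) := by
  have e0 : Finset.range (p + q + r) = Finset.Ico 0 p ∪
      (Finset.Ico (p + q + r - r) (p + q + r) ∪ Finset.Ico p (p + q)) := by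
    ext x; simp only [Finset.mem_union, Finset.mem_range, Finset.mem_Ico]; omega
  have e1 : (Finset.Ico 0 p).erase 0 = Finset.Ico 1 p := Ico_erase_left
  have e2 : (Finset.Ico (p + q + r - r) (p + q + r) ∪ Finset.Ico p (p + q)).erase (p + q) =
      Finset.Ico (p + q + r - (r - 1)) (p + q + r) ∪ Finset.Ico p (p + q) := by
    ext x; simp only [Finset.mem_union, Finset.mem_erase, Finset.mem_Ico]; omega
  rw [e0, perS_bridge (a := 0) (b := p + q), e1, e2, dM_adj (by omega) (by unfold dRel; omega),
    dM_adj (by omega) (by unfold dRel; omega)]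
  · ring
  · rw [Finset.disjoint_left]
    intro x
    simp only [Finset.mem_union, Finset.mem_Ico]; omega
  · simp only [Finset.mem_Ico]; omega
  · simp only [Finset.mem_union, Finset.mem_Ico]; omega
  · intro i hi j hj hne
    simp only [Finset.mem_union, Finset.mem_Ico] at hi hj
    exact dM_nadj (by omega) (by
        unfold dRel
        rintro ((h | h | h | h | h | h | h) | (h | h | h | h | h | h | h)) <;> omega)
  · intro i hi j hj hne
    simp only [Finset.mem_union, Finset.mem_Ico] at hi hj
    exact dM_nadj (by omega) (by
        unfold dRel
        rintro ((h | h | h | h | h | h | h) | (h | h | h | h | h | h | h)) <;> omega)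

/-- auxiliary polynomial `f_p`. -/
def fP (p : ℕ) : ℚ[X] :=
  (1 - X + 2 * X ^ 2) + (-1) ^ p * X ^ p * (2 * (1 + X ^ 2) + X ^ p * (1 + X))

/-- auxiliary polynomial `g_p`. -/
def gP (p : ℕ) : ℚ[X] :=
  X * (1 - X) - (-1) ^ p * X ^ p * (2 * (1 + X ^ 2) + X ^ p * (X ^ 2 + X + 2))

/-- the invariant as a polynomial in `z`, `x = 2 + 1/z - z`. -/
def PhiP (p q r : ℕ) : ℚ[X] :=
  fP p * fP q + (-1) ^ r * X ^ (2 * r + 2) * (gP p * gP q)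

lemma fP_closed {z t A B : ℚ} (hz : z * t = 1) (p : ℕ)
    (hA : (t - (-z)) * A = (t ^ p + (-z) ^ p) * (t - (-z)) - (t ^ p - (-z) ^ p) +
      2 * (-1) ^ p * (t - (-z)))
    (hB : (t - (-z)) * B = t ^ p - (-z) ^ p) :
    z ^ (p + 2) * ((t - (-z)) * (A * t + B)) = (fP p).eval z ∧
    z ^ p * ((t - (-z)) * (A * (-z) + B)) = (gP p).eval z := by
  have hz0 : z ≠ 0 := left_ne_zero_of_mul_eq_one hz
  have ht : t = z⁻¹ := eq_inv_of_mul_eq_one_right hz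
  have hs : (-z) ^ p = (-1) ^ p * z ^ p := by rw [← mul_pow]; simp
  have e1 : (t - (-z)) * (A * t + B) = ((t ^ p + (-z) ^ p) * (t - (-z)) - (t ^ p - (-z) ^ p) +
      2 * (-1) ^ p * (t - (-z))) * t + (t ^ p - (-z) ^ p) := by
    linear_combination t * hA + hB
  have e2 : (t - (-z)) * (A * (-z) + B) = ((t ^ p + (-z) ^ p) * (t - (-z)) - (t ^ p - (-z) ^ p) +
      2 * (-1) ^ p * (t - (-z))) * (-z) + (t ^ p - (-z) ^ p) := by
    linear_combination (-z) * hA + hB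
  rw [e1, e2, hs]
  have htp : z ^ p * t ^ p = 1 := by rw [← mul_pow, hz, one_pow]
  generalize t ^ p = T at *
  have hT : T = (z ^ p)⁻¹ := eq_inv_of_mul_eq_one_right htp
  subst hT ht
  constructor
  · simp [fP]
    field_simp
    ring
  · simp [gP]
    field_simp
    ring

lemma PhiP_closed {z : ℚ} (hz : z ≠ 0) {p q r : ℕ} (hp : 3 ≤ p) (hq : 3 ≤ q) (hr : 1 ≤ r) :
    z ^ (p + q + r + 3) * (z⁻¹ + z) ^ 3 *
      perS (dM p q r (z⁻¹ - z)) (Finset.range (p + q + r)) = (PhiP p q r).eval z := by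
  obtain ⟨t, ht⟩ : ∃ t, t = z⁻¹ := ⟨_, rfl⟩
  have hzt : z * t = 1 := by rw [ht]; exact mul_inv_cancel₀ hz
  have hts : t * (-z) = -1 := by linear_combination -hzt
  rw [← ht]
  obtain ⟨y, hy⟩ : ∃ y, y = t + (-z) := ⟨_, rfl⟩
  rw [show t - z = y by rw [hy]; ring]
  obtain ⟨p1, p2⟩ := dM_cycle_p hts hy hp hq hr
  obtain ⟨q1, q2⟩ := dM_cycle_q hts hy hp hq hr
  have t1 := dM_tail hts hy hp hq hr r le_rfl
  have t2 := dM_tail hts hy hp hq hr (r - 1) (by omega)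
  obtain ⟨fp, gp⟩ := fP_closed hzt p p1 p2
  obtain ⟨fq, gq⟩ := fP_closed hzt q q1 q2
  rw [dM_bridge y hp hq hr]
  simp only [PhiP, Polynomial.eval_add, Polynomial.eval_mul, Polynomial.eval_pow,
    Polynomial.eval_neg, Polynomial.eval_one, Polynomial.eval_X]
  rw [← fp, ← fq, ← gp, ← gq]
  generalize perS (dM p q r y) (Finset.Ico p (p + q)) = A at *
  generalize perS (dM p q r y) (Finset.Ico (p + 1) (p + q)) = B at *
  generalize perS (dM p q r y) (Finset.Ico 0 p) = A' at *
  generalize perS (dM p q r y) (Finset.Ico 1 p) = B' at *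
  obtain ⟨k, rfl⟩ : ∃ k, r = k + 1 := ⟨r - 1, by omega⟩
  simp only [Nat.add_sub_cancel] at t1 t2 ⊢
  generalize perS (dM p q (k + 1) y) (Finset.Ico (p + q) (p + q + (k + 1)) ∪ Finset.Ico p (p + q)) = H1 at *
  generalize perS (dM p q (k + 1) y) (Finset.Ico (p + q + (k + 1) - k) (p + q + (k + 1)) ∪ Finset.Ico p (p + q)) = H2 at *
  have hs : (-z) ^ k = (-1) ^ k * z ^ k := by rw [← mul_pow]; simp
  have hk : z ^ k * t ^ k = 1 := by rw [← mul_pow, hzt, one_pow]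
  rw [pow_succ, pow_succ (-z), hs] at t1
  rw [hs] at t2
  have main : (t + z) * (A' * H1 + B' * H2) = t ^ k * ((A' * t + B') * (A * t + B)) -
      (-1) ^ k * z ^ k * ((A' * (-z) + B') * (A * (-z) + B)) := by
    linear_combination A' * t1 + B' * t2
  have : z ^ (p + q + (k + 1) + 3) * (t + z) ^ 3 * (A' * H1 + B' * H2) =
      z ^ (p + q + k + 4) * (t + z) ^ 2 * ((t + z) * (A' * H1 + B' * H2)) := by ring
  rw [this, main]
  linear_combination (z ^ (p + 2) * z ^ (q + 2) * (t + z) ^ 2 * ((A' * t + B') * (A * t + B))) * hk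

end DMat

/-! ### Linking `qPermPoly` with `perS` -/

section Link

/-- adjacency on natural numbers. -/
def dAdj (p q r i j : ℕ) : Prop := i ≠ j ∧ (dRel p q r i j ∨ dRel p q r j i)

lemma nbr_two_p {p q r i : ℕ} (hp : 3 ≤ p) (hq : 3 ≤ q) (h1 : 1 ≤ i) (h2 : i < p)
    (j : ℕ) (hj : j < p + q + r) : dAdj p q r i j ↔ j = i - 1 ∨ j = if i + 1 = p then 0 else i + 1 := by
  unfold dAdj dRel
  constructor
  · rintro ⟨h0, ((h | h | h | h | h | h | h) | (h | h | h | h | h | h | h))⟩ <;> split_ifs <;> omega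
  · rintro (h | h)
    · refine ⟨by omega, Or.inr (Or.inl (by omega))⟩
    · split_ifs at h with e
      · refine ⟨by omega, Or.inl (Or.inr (Or.inl (by omega)))⟩
      · refine ⟨by omega, Or.inl (Or.inl (by omega))⟩

lemma nbr_two_q {p q r i : ℕ} (hp : 3 ≤ p) (hq : 3 ≤ q) (h1 : p + 1 ≤ i) (h2 : i < p + q)
    (hr : 1 ≤ r) (j : ℕ) (hj : j < p + q + r) :
    dAdj p q r i j ↔ j = i - 1 ∨ j = if i + 1 = p + q then p else i + 1 := by
  unfold dAdj dRel
  constructor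
  · rintro ⟨h0, ((h | h | h | h | h | h | h) | (h | h | h | h | h | h | h))⟩ <;> split_ifs <;> omega
  · rintro (h | h)
    · refine ⟨by omega, Or.inr (Or.inr (Or.inr (Or.inl (by omega))))⟩
    · split_ifs at h with e
      · refine ⟨by omega, Or.inl (Or.inr (Or.inr (Or.inr (Or.inl (by omega)))))⟩
      · refine ⟨by omega, Or.inl (Or.inr (Or.inr (Or.inl (by omega))))⟩

lemma nbr_two_r {p q r i : ℕ} (hp : 3 ≤ p) (hq : 3 ≤ q) (h1 : p + q ≤ i) (h2 : i < p + q + r)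
    (j : ℕ) (hj : j < p + q + r) :
    dAdj p q r i j ↔ (j = if i = p + q then 0 else i - 1) ∨
      j = if i + 1 = p + q + r then p else i + 1 := by
  unfold dAdj dRel
  constructor
  · rintro ⟨h0, ((h | h | h | h | h | h | h) | (h | h | h | h | h | h | h))⟩ <;> split_ifs <;> omega
  · rintro (h | h)
    · split_ifs at h with e
      · refine ⟨by omega, Or.inr (Or.inr (Or.inr (Or.inr (Or.inr (Or.inr (Or.inl (by omega)))))))⟩
      · refine ⟨by omega, Or.inr (Or.inr (Or.inr (Or.inr (Or.inr (Or.inl (by omega))))))⟩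
    · split_ifs at h with e
      · refine ⟨by omega, Or.inl (Or.inr (Or.inr (Or.inr (Or.inr (Or.inr (Or.inr (by omega)))))))⟩
      · refine ⟨by omega, Or.inl (Or.inr (Or.inr (Or.inr (Or.inr (Or.inl (by omega))))))⟩

lemma nbr_zero {p q r : ℕ} (hp : 3 ≤ p) (hq : 3 ≤ q) (j : ℕ) (hj : j < p + q + r) :
    dAdj p q r 0 j ↔ j = 1 ∨ j = p - 1 ∨ j = p + q := by
  unfold dAdj dRel
  constructor
  · rintro ⟨h0, ((h | h | h | h | h | h | h) | (h | h | h | h | h | h | h))⟩ <;> omega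
  · rintro (h | h | h)
    · refine ⟨by omega, Or.inl (Or.inl (by omega))⟩
    · refine ⟨by omega, Or.inr (Or.inr (Or.inl (by omega)))⟩
    · refine ⟨by omega, Or.inl (Or.inr (Or.inr (Or.inr (Or.inr (Or.inr (Or.inl (by omega)))))))⟩

lemma nbr_p {p q r : ℕ} (hp : 3 ≤ p) (hq : 3 ≤ q) (hr : 1 ≤ r) (j : ℕ) (hj : j < p + q + r) :
    dAdj p q r p j ↔ j = p + 1 ∨ j = p + q - 1 ∨ j = p + q + r - 1 := by
  unfold dAdj dRel
  constructor
  · rintro ⟨h0, ((h | h | h | h | h | h | h) | (h | h | h | h | h | h | h))⟩ <;> omega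
  · rintro (h | h | h)
    · refine ⟨by omega, Or.inl (Or.inr (Or.inr (Or.inl (by omega))))⟩
    · refine ⟨by omega, Or.inr (Or.inr (Or.inr (Or.inr (Or.inl (by omega)))))⟩
    · refine ⟨by omega, Or.inr (Or.inr (Or.inr (Or.inr (Or.inr (Or.inr (Or.inr (by omega)))))))⟩

lemma dGraph_adj {p q r : ℕ} (i j : Fin (p + q + r)) :
    (dGraph p q r).Adj i j ↔ dAdj p q r i j := by
  unfold dGraph dAdj dRel
  rw [SimpleGraph.fromRel_adj, ne_eq, ne_eq, Fin.ext_iff]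

lemma deg_eq_two {p q r : ℕ} {i : Fin (p + q + r)} {a b : ℕ} (ha : a < p + q + r)
    (hb : b < p + q + r) (hab : a ≠ b)
    (h : ∀ j, j < p + q + r → (dAdj p q r i j ↔ j = a ∨ j = b)) :
    (dGraph p q r).degree i = 2 := by
  rw [← SimpleGraph.card_neighborFinset_eq_degree, Finset.card_eq_two]
  refine ⟨⟨a, ha⟩, ⟨b, hb⟩, by simpa using hab, ?_⟩
  ext j
  rw [SimpleGraph.mem_neighborFinset, dGraph_adj, h j j.2]
  simp [Fin.ext_iff]

lemma deg_eq_three {p q r : ℕ} {i : Fin (p + q + r)} {a b c : ℕ} (ha : a < p + q + r)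
    (hb : b < p + q + r) (hc : c < p + q + r) (hab : a ≠ b) (hac : a ≠ c) (hbc : b ≠ c)
    (h : ∀ j, j < p + q + r → (dAdj p q r i j ↔ j = a ∨ j = b ∨ j = c)) :
    (dGraph p q r).degree i = 3 := by
  rw [← SimpleGraph.card_neighborFinset_eq_degree, Finset.card_eq_three]
  refine ⟨⟨a, ha⟩, ⟨b, hb⟩, ⟨c, hc⟩, by simpa using hab, by simpa using hac, by simpa using hbc, ?_⟩
  ext j
  rw [SimpleGraph.mem_neighborFinset, dGraph_adj, h j j.2]
  simp [Fin.ext_iff]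

lemma dGraph_degree {p q r : ℕ} (hp : 3 ≤ p) (hq : 3 ≤ q) (hr : 1 ≤ r) (i : Fin (p + q + r)) :
    (dGraph p q r).degree i = if (i : ℕ) = 0 ∨ (i : ℕ) = p then 3 else 2 := by
  have hi := i.2
  by_cases h0 : (i : ℕ) = 0
  · rw [if_pos (Or.inl h0)]
    refine deg_eq_three (a := 1) (b := p - 1) (c := p + q) (by omega) (by omega) (by omega)
      (by omega) (by omega) (by omega) ?_
    rw [h0]
    exact nbr_zero hp hq
  by_cases h1 : (i : ℕ) = p
  · rw [if_pos (Or.inr h1)]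
    refine deg_eq_three (a := p + 1) (b := p + q - 1) (c := p + q + r - 1) (by omega) (by omega)
      (by omega) (by omega) (by omega) (by omega) ?_
    rw [h1]
    exact nbr_p hp hq hr
  rw [if_neg (by omega)]
  rcases lt_or_ge (i : ℕ) p with h2 | h2
  · exact deg_eq_two (by omega) (by split_ifs <;> omega) (by split_ifs <;> omega)
      (nbr_two_p hp hq (by omega) h2)
  rcases lt_or_ge (i : ℕ) (p + q) with h3 | h3
  · exact deg_eq_two (by omega) (by split_ifs <;> omega) (by split_ifs <;> omega)
      (nbr_two_q hp hq (by omega) h3 hr)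
  · exact deg_eq_two (by split_ifs <;> omega) (by split_ifs <;> omega) (by split_ifs <;> omega)
      (nbr_two_r hp hq h3 hi)

/-- `Fin n` as the subtype of `range n`. -/
def finRange (n : ℕ) : Fin n ≃ (Finset.range n : Finset ℕ) where
  toFun i := ⟨i, Finset.mem_range.2 i.2⟩
  invFun i := ⟨i, Finset.mem_range.1 i.2⟩
  left_inv _ := rfl
  right_inv _ := rfl

lemma qPermPoly_eval {p q r : ℕ} (hp : 3 ≤ p) (hq : 3 ≤ q) (hr : 1 ≤ r) (y : ℚ) :
    (qPermPoly (dGraph p q r)).eval (y + 2) =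
      perS (dM p q r y) (Finset.range (p + q + r)) := by
  have h1 : perS (dM p q r y) (Finset.range (p + q + r)) =
      Matrix.permanent (Matrix.of fun i j : Fin (p + q + r) => dM p q r y i j) := by
    unfold perS
    rw [← permanent_reindex (finRange (p + q + r))]
    rfl
  rw [h1]
  unfold qPermPoly Matrix.permanent
  rw [Polynomial.eval_finsetSum]
  refine Finset.sum_congr (by ext; simp only [Finset.mem_univ]) fun σ _ => ?_
  rw [Polynomial.eval_prod]
  refine Finset.prod_congr rfl fun k _ => ?_
  generalize σ k = i
  simp only [Matrix.sub_apply, Matrix.map_apply, signlessLapMatrix, Matrix.add_apply,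
    Polynomial.eval_sub, Polynomial.eval_C, SimpleGraph.degMatrix, SimpleGraph.adjMatrix_apply,
    Matrix.of_apply, Matrix.diagonal]
  by_cases h : i = k
  · subst h
    rw [if_pos rfl, if_pos rfl, dGraph_degree hp hq hr]
    unfold dM
    rw [if_pos rfl, if_neg ((dGraph p q r).irrefl), Polynomial.eval_X]
    split_ifs
    · push_cast; ring
    · push_cast; ring
  · have h' : (i : ℕ) ≠ k := fun e => h (Fin.ext e)
    rw [if_neg h, if_neg h, Polynomial.eval_zero]
    unfold dM
    rw [if_neg h', dGraph_adj]
    unfold dAdj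
    by_cases g : dRel p q r i k ∨ dRel p q r k i
    · rw [if_pos ⟨h', g⟩, if_pos g]; ring
    · rw [if_neg (fun x => g x.2), if_neg g]; ring

end Link

section Swap

lemma dRel_swap_aux {p q r i j a b : ℕ} (hp : 3 ≤ p) (hq : 3 ≤ q) (hr : 1 ≤ r)
    (hi : i < p + q + r) (hj : j < p + q + r)
    (ha : a = if i < p then q + i else if i < p + q then i - p else 2 * p + 2 * q + r - 1 - i)
    (hb : b = if j < p then q + j else if j < p + q then j - p else 2 * p + 2 * q + r - 1 - j)
    (h : dRel p q r i j) : dRel q p r a b ∨ dRel q p r b a := by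
  unfold dRel at *
  rcases h with h | h | h | h | h | h | h
  · rw [if_pos (by omega)] at ha hb
    exact Or.inl (Or.inr (Or.inr (Or.inl (by omega))))
  · rw [if_pos (by omega)] at ha hb
    exact Or.inl (Or.inr (Or.inr (Or.inr (Or.inl (by omega)))))
  · rw [if_neg (by omega), if_pos (by omega)] at ha hb
    exact Or.inl (Or.inl (by omega))
  · rw [if_neg (by omega), if_pos (by omega)] at ha hb
    exact Or.inl (Or.inr (Or.inl (by omega)))
  · rw [if_neg (by omega), if_neg (by omega)] at ha hb
    exact Or.inr (Or.inr (Or.inr (Or.inr (Or.inr (Or.inl (by omega))))))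
  · rw [if_pos (by omega)] at ha
    rw [if_neg (by omega), if_neg (by omega)] at hb
    exact Or.inr (Or.inr (Or.inr (Or.inr (Or.inr (Or.inr (Or.inr (by omega)))))))
  · rw [if_neg (by omega), if_neg (by omega)] at ha
    rw [if_neg (by omega), if_pos (by omega)] at hb
    exact Or.inr (Or.inr (Or.inr (Or.inr (Or.inr (Or.inr (Or.inl (by omega)))))))

/-- the swap on vertices -/
def swapV (p q r i : ℕ) : ℕ :=
  if i < p then q + i else if i < p + q then i - p else 2 * p + 2 * q + r - 1 - i

lemma swapV_lt {p q r i : ℕ} (hi : i < p + q + r) : swapV p q r i < q + p + r := by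
  unfold swapV; split_ifs <;> omega

lemma swapV_swapV {p q r i : ℕ} (hi : i < p + q + r) : swapV q p r (swapV p q r i) = i := by
  unfold swapV; split_ifs <;> omega

lemma dAdj_swap {p q r i j : ℕ} (hp : 3 ≤ p) (hq : 3 ≤ q) (hr : 1 ≤ r)
    (hi : i < p + q + r) (hj : j < p + q + r) (h : dAdj p q r i j) :
    dAdj q p r (swapV p q r i) (swapV p q r j) := by
  refine ⟨fun e => h.1 ?_, ?_⟩
  · rw [← swapV_swapV hi, e, swapV_swapV hj]
  · rcases h.2 with h | h
    · exact dRel_swap_aux hp hq hr hi hj rfl rfl h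
    · exact (dRel_swap_aux hp hq hr hj hi rfl rfl h).symm

/-- `d(p,q,r)` and `d(q,p,r)` are isomorphic. -/
def dSwap {p q r : ℕ} (hp : 3 ≤ p) (hq : 3 ≤ q) (hr : 1 ≤ r) : dGraph p q r ≃g dGraph q p r where
  toFun i := ⟨swapV p q r i, swapV_lt i.2⟩
  invFun i := ⟨swapV q p r i, swapV_lt i.2⟩
  left_inv i := Fin.ext (swapV_swapV i.2)
  right_inv i := Fin.ext (swapV_swapV i.2)
  map_rel_iff' := by
    intro i j
    rw [dGraph_adj, dGraph_adj]
    simp only [Equiv.coe_fn_mk]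
    constructor
    · intro h
      have := dAdj_swap hq hp hr (swapV_lt i.2) (swapV_lt j.2) h
      rwa [swapV_swapV i.2, swapV_swapV j.2] at this
    · exact dAdj_swap hp hq hr i.2 j.2

end Swap

/-! ### Comparing lowest coefficients -/

section Coeff

lemma coeff_low {e m : ℕ} (h : m ≤ e) (U : ℚ[X]) :
    (X ^ e * U).coeff m = if e = m then U.eval 0 else 0 := by
  rw [Polynomial.coeff_X_pow_mul', ← Polynomial.coeff_zero_eq_eval_zero]
  by_cases h' : e = m
  · subst h'; simp
  · rw [if_neg (by omega), if_neg h']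

/-- `1 - z + 2 z^2` -/
def alP : ℚ[X] := 1 - X + 2 * X ^ 2

lemma alP_zero : alP.eval 0 = 1 := by simp [alP]

lemma fP_form {p : ℕ} (hp : 3 ≤ p) : ∃ U : ℚ[X], fP p = alP + X ^ p * U ∧
    U.eval 0 = 2 * (-1) ^ p :=
  ⟨(-1) ^ p * (2 * (1 + X ^ 2) + X ^ p * (1 + X)), by unfold fP alP; ring, by
    have : p ≠ 0 := by omega
    simp [this]; ring⟩

lemma fP_zero {p : ℕ} (hp : 3 ≤ p) : (fP p).eval 0 = 1 := by
  have : p ≠ 0 := by omega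
  simp [fP, this]

lemma gP_form {p : ℕ} (hp : 3 ≤ p) : ∃ K : ℚ[X], gP p = X * K ∧ K.eval 0 = 1 := by
  obtain ⟨k, rfl⟩ : ∃ k, p = k + 3 := ⟨p - 3, by omega⟩
  refine ⟨(1 - X) - (-1) ^ (k + 3) * X ^ (k + 2) * (2 * (1 + X ^ 2) + X ^ (k + 3) * (X ^ 2 + X + 2)),
    by unfold gP; ring, by simp⟩

lemma gP_form' (p : ℕ) : ∃ V : ℚ[X], gP p = X * (1 - X) + X ^ p * V :=
  ⟨-((-1) ^ p * (2 * (1 + X ^ 2) + X ^ p * (X ^ 2 + X + 2))), by unfold gP; ring⟩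

lemma PhiP_comm (p q r : ℕ) : PhiP p q r = PhiP q p r := by unfold PhiP; ring

lemma PhiP_form {p q : ℕ} (r : ℕ) (hp : 3 ≤ p) (hq : 3 ≤ q) : ∃ b c : ℚ[X],
    PhiP p q r = fP p * alP + X ^ q * b + X ^ (2 * r + 4) * c ∧
    b.eval 0 = 2 * (-1) ^ q ∧ c.eval 0 = (-1) ^ r := by
  obtain ⟨U, hU, hU0⟩ := fP_form hq
  obtain ⟨K, hK, hK0⟩ := gP_form hp
  obtain ⟨L, hL, hL0⟩ := gP_form hq
  refine ⟨U * fP p, (-1) ^ r * (K * L), ?_, ?_, ?_⟩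
  · unfold PhiP; rw [hU, hK, hL]; ring
  · simp [hU0, fP_zero hp]
  · simp [hK0, hL0]

lemma PhiP_form2 {p q : ℕ} (r : ℕ) (hp : 3 ≤ p) (hq : 3 ≤ q) : ∃ a b c : ℚ[X],
    PhiP p q r = alP * alP + X ^ p * a + X ^ q * b + X ^ (2 * r + 4) * c ∧
    a.eval 0 = 2 * (-1) ^ p ∧ b.eval 0 = 2 * (-1) ^ q ∧ c.eval 0 = (-1) ^ r := by
  obtain ⟨b, c, h, hb, hc⟩ := PhiP_form r hp hq
  obtain ⟨U, hU, hU0⟩ := fP_form hp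
  refine ⟨U * alP, b, c, ?_, ?_, hb, hc⟩
  · rw [h, hU]; ring
  · simp [hU0, alP_zero]

lemma PhiP_form3 {p q : ℕ} (r : ℕ) (hp : 3 ≤ p) (hq : 3 ≤ q) : ∃ a b c d : ℚ[X],
    PhiP p q r = (alP * alP + (-1) ^ r * X ^ (2 * r + 2) * (X * (1 - X)) ^ 2) +
      X ^ p * a + X ^ q * b + X ^ (2 * r + 2 + p) * c + X ^ (2 * r + 2 + q) * d ∧
    a.eval 0 = 2 * (-1) ^ p := by
  obtain ⟨U, hU, hU0⟩ := fP_form hp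
  obtain ⟨W, hW, hW0⟩ := fP_form hq
  obtain ⟨K, hK⟩ := gP_form' p
  obtain ⟨L, hL⟩ := gP_form' q
  refine ⟨U * alP, W * fP p, (-1) ^ r * K * (X * (1 - X)), (-1) ^ r * L * gP p, ?_, ?_⟩
  · unfold PhiP; rw [hU, hW, hK, hL]; ring
  · simp [hU0, alP_zero]

lemma case_eq {p q r q' r' : ℕ} (hp : 3 ≤ p) (hq : 3 ≤ q) (hq' : 3 ≤ q')
    (hn : q + r = q' + r') (hlt : q < q') (h : PhiP p q r = PhiP p q' r') : False := by
  obtain ⟨b, c, e, hb, hc⟩ := PhiP_form r hp hq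
  obtain ⟨b', c', e', hb', hc'⟩ := PhiP_form r' hp hq'
  rw [e, e'] at h
  obtain ⟨m, hm⟩ : ∃ m, m = min q (2 * r' + 4) := ⟨_, rfl⟩
  have h2 := congrArg (fun P => Polynomial.coeff P m) h
  simp only [Polynomial.coeff_add] at h2
  rw [coeff_low (by omega), coeff_low (by omega), coeff_low (by omega), coeff_low (by omega),
    hb, hc, hb', hc', if_neg (show ¬ 2 * r + 4 = m by omega), if_neg (show ¬ q' = m by omega)] at h2
  rcases neg_one_pow_eq_or ℚ q with s1 | s1 <;> rcases neg_one_pow_eq_or ℚ r' with s2 | s2 <;>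
    rw [s1, s2] at h2 <;> split_ifs at h2 <;> first | omega | linarith

lemma case_lt {p q r p' q' r' : ℕ} (hp : 3 ≤ p) (hq : 3 ≤ q) (hp' : 3 ≤ p') (hq' : 3 ≤ q')
    (hn : p + q + r = p' + q' + r') (hpq : p ≤ q) (hpq' : p' ≤ q') (hlt : p < p')
    (h : PhiP p q r = PhiP p' q' r') : False := by
  by_cases hr : r = r'
  · subst hr
    obtain ⟨a, b, c, d, e, ha⟩ := PhiP_form3 r hp hq
    obtain ⟨a', b', c', d', e', ha'⟩ := PhiP_form3 r hp' hq'
    rw [e, e'] at h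
    have h2 := congrArg (fun P => Polynomial.coeff P p) h
    simp only [Polynomial.coeff_add] at h2
    iterate 8 rw [coeff_low (by omega)] at h2
    rw [if_pos rfl, if_neg (by omega), if_neg (by omega), if_neg (by omega), if_neg (by omega),
      if_neg (by omega), if_neg (by omega), if_neg (by omega), ha] at h2
    rcases neg_one_pow_eq_or ℚ p with s1 | s1 <;> rw [s1] at h2 <;> linarith
  · obtain ⟨a, b, c, e, ha, hb, hc⟩ := PhiP_form2 r hp hq
    obtain ⟨a', b', c', e', ha', hb', hc'⟩ := PhiP_form2 r' hp' hq'
    rw [e, e'] at h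
    obtain ⟨m, hm⟩ : ∃ m, m = min p (min (2 * r + 4) (2 * r' + 4)) := ⟨_, rfl⟩
    have h2 := congrArg (fun P => Polynomial.coeff P m) h
    simp only [Polynomial.coeff_add] at h2
    iterate 6 rw [coeff_low (by omega)] at h2
    rw [ha, hb, hc, ha', hb', hc', if_neg (show ¬ p' = m by omega),
      if_neg (show ¬ q' = m by omega)] at h2
    by_cases hqp : q = p
    · subst hqp
      rcases neg_one_pow_eq_or ℚ q with s1 | s1 <;> rcases neg_one_pow_eq_or ℚ r with s2 | s2 <;>
      rcases neg_one_pow_eq_or ℚ r' with s3 | s3 <;>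
      rw [s1, s2, s3] at h2 <;> split_ifs at h2 <;> first | omega | linarith
    · rw [if_neg (show ¬ q = m by omega)] at h2
      rcases neg_one_pow_eq_or ℚ p with s1 | s1 <;> rcases neg_one_pow_eq_or ℚ r with s2 | s2 <;>
      rcases neg_one_pow_eq_or ℚ r' with s3 | s3 <;>
      rw [s1, s2, s3] at h2 <;> split_ifs at h2 <;> first | omega | linarith

lemma sorted_inj {p q r p' q' r' : ℕ} (hp : 3 ≤ p) (hq : 3 ≤ q) (hp' : 3 ≤ p') (hq' : 3 ≤ q')
    (hn : p + q + r = p' + q' + r') (hpq : p ≤ q) (hpq' : p' ≤ q')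
    (h : PhiP p q r = PhiP p' q' r') : p = p' ∧ q = q' ∧ r = r' := by
  rcases lt_trichotomy p p' with h1 | h1 | h1
  · exact (case_lt hp hq hp' hq' hn hpq hpq' h1 h).elim
  · subst h1
    rcases lt_trichotomy q q' with h2 | h2 | h2
    · exact (case_eq hp hq hq' (by omega) h2 h).elim
    · subst h2
      exact ⟨rfl, rfl, by omega⟩
    · exact (case_eq hp hq' hq (by omega) h2 h.symm).elim
  · exact (case_lt hp' hq' hp hq hn.symm hpq' hpq h1 h.symm).elim

lemma PhiP_zero {p q r : ℕ} (hp : 3 ≤ p) (hq : 3 ≤ q) : (PhiP p q r).eval 0 = 1 := by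
  simp [PhiP, fP_zero hp, fP_zero hq]

lemma PhiP_of_qPermPoly {p q r p' q' r' : ℕ} (hp : 3 ≤ p) (hq : 3 ≤ q) (hr : 1 ≤ r)
    (hp' : 3 ≤ p') (hq' : 3 ≤ q') (hr' : 1 ≤ r')
    (h : qPermPoly (dGraph p q r) = qPermPoly (dGraph p' q' r')) :
    p + q + r = p' + q' + r' ∧ PhiP p q r = PhiP p' q' r' := by
  have key : X ^ (p' + q' + r') * PhiP p q r = X ^ (p + q + r) * PhiP p' q' r' := by
    refine Polynomial.funext fun z => ?_
    by_cases hz : z = 0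
    · subst hz
      simp only [Polynomial.eval_mul, Polynomial.eval_pow, Polynomial.eval_X]
      rw [zero_pow (by omega), zero_pow (by omega)]
      ring
    · simp only [Polynomial.eval_mul, Polynomial.eval_pow, Polynomial.eval_X]
      rw [← PhiP_closed hz hp hq hr, ← PhiP_closed hz hp' hq' hr', ← qPermPoly_eval hp hq hr,
        ← qPermPoly_eval hp' hq' hr', h]
      ring
  have hn : p + q + r = p' + q' + r' := by
    by_contra hne
    have h2 := congrArg (fun P => Polynomial.coeff P (min (p + q + r) (p' + q' + r'))) key
    rw [coeff_low (by omega), coeff_low (by omega), PhiP_zero hp hq, PhiP_zero hp' hq'] at h2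
    split_ifs at h2 <;> first | omega | norm_num at h2
  refine ⟨hn, ?_⟩
  rw [hn] at key
  exact mul_left_cancel₀ (pow_ne_zero _ Polynomial.X_ne_zero) key

end Coeff

/-- **Lemma 4.2.** No two non-isomorphic graphs of the form `d(p,q,r)` share the same
signless Laplacian permanental polynomial. -/
theorem dGraph_qPermPoly_injective
    (p q r p' q' r' : ℕ) (hp : 3 ≤ p) (hq : 3 ≤ q) (hr : 1 ≤ r)
    (hp' : 3 ≤ p') (hq' : 3 ≤ q') (hr' : 1 ≤ r')
    (h : qPermPoly (dGraph p q r) = qPermPoly (dGraph p' q' r')) :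
    Nonempty (dGraph p q r ≃g dGraph p' q' r') := by
  obtain ⟨hn, hP⟩ := PhiP_of_qPermPoly hp hq hr hp' hq' hr' h
  rcases le_total p q with h1 | h1 <;> rcases le_total p' q' with h2 | h2
  · obtain ⟨rfl, rfl, rfl⟩ := sorted_inj hp hq hp' hq' hn h1 h2 hP
    exact ⟨SimpleGraph.Iso.refl⟩
  · rw [PhiP_comm p'] at hP
    obtain ⟨rfl, rfl, rfl⟩ := sorted_inj hp hq hq' hp' (by omega) h1 h2 hP
    exact ⟨dSwap hp hq hr⟩
  · rw [PhiP_comm p] at hP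
    obtain ⟨rfl, rfl, rfl⟩ := sorted_inj hq hp hp' hq' (by omega) h1 h2 hP
    exact ⟨dSwap hp hq hr⟩
  · rw [PhiP_comm p, PhiP_comm p'] at hP
    obtain ⟨rfl, rfl, rfl⟩ := sorted_inj hq hp hq' hp' (by omega) h1 h2 hP
    exact ⟨SimpleGraph.Iso.refl⟩
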